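/- Itzykson–Zuber–Harish-Chandra formula: for every N ≥ 1 and injective families a, b : Fin N → ℂ, with A := diag(a), B := diag(b), one has ∫_{U(N)} exp(Tr(A·U·B·U*)) dU = (∏_{k=1}^{N−1} k!) · det((exp(a_i·b_j))_{1≤i,j≤N}) / (Δ(a)·Δ(b)), where dU is the Haar probability measure on U(N). -/

import Mathlib

open MeasureTheory Matrix

namespace HCIZ

/-! ### Algebraic preliminaries -/

/-- The commutator operator. -/
def ad {R : Type*} [Ring R] (L x : R) : R := L * x - x * L

lemma ad_mul {R : Type*} [Ring R] (L x y : R) : ad L (x * y) = ad L x * y + x * ad L y := by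
  simp only [ad]; noncomm_ring

lemma ad_iter_mul {R : Type*} [Ring R] (L x y : R) (hx : ad L x = y) (hy : ad L y = 0) (z : R)
    (m : ℕ) : (ad L)^[m + 1] (x * z)
      = x * (ad L)^[m + 1] z + ((m + 1 : ℕ) : R) * (y * (ad L)^[m] z) := by
  have hadd : ∀ u v : R, ad L (u + v) = ad L u + ad L v := by
    intro u v; simp only [ad]; noncomm_ring
  have hnat : ∀ (n : ℕ) (u : R), ad L ((n : R) * u) = (n : R) * ad L u := by
    intro n u
    simp only [ad, mul_sub]
    rw [← mul_assoc L, ← (Nat.cast_commute n L).eq, mul_assoc, mul_assoc]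
  induction m with
  | zero => simp [ad_mul, hx, add_comm]
  | succ m ih =>
    rw [Function.iterate_succ_apply', ih, hadd, hnat, ad_mul, ad_mul, hx, hy,
      ← Function.iterate_succ_apply' (ad L), ← Function.iterate_succ_apply' (ad L)]
    push_cast
    noncomm_ring

lemma ad_iter_zero {R : Type*} [Ring R] (L : R) (m : ℕ) : (ad L)^[m] 0 = 0 := by
  induction m with
  | zero => rfl
  | succ m ih => rw [Function.iterate_succ_apply', ih]; simp [ad]

lemma ad_iter_pow_aux {R : Type*} [Ring R] (L x y : R) (hx : ad L x = y) (hy : ad L y = 0)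
    (k : ℕ) : (ad L)^[k + 1] (x ^ k) = 0 ∧ (ad L)^[k] (x ^ k) = (k.factorial : R) * y ^ k := by
  induction k with
  | zero => simp [ad]
  | succ k ih =>
    have h2 : (ad L)^[k + 1] (x ^ (k + 1)) = ((k + 1).factorial : R) * y ^ (k + 1) := by
      rw [pow_succ' x, ad_iter_mul L x y hx hy, ih.1, ih.2, pow_succ', Nat.factorial_succ]
      push_cast
      rw [mul_zero, zero_add, ← mul_assoc y, ← (Nat.cast_commute k.factorial y).eq]
      simp only [mul_assoc]
    refine ⟨?_, h2⟩
    rw [pow_succ' x, ad_iter_mul L x y hx hy, Function.iterate_succ_apply', ih.1]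
    simp [ad]

lemma ad_iter_pow {R : Type*} [Ring R] (L x y : R) (hx : ad L x = y) (hy : ad L y = 0)
    (k : ℕ) : (ad L)^[k] (x ^ k) = (k.factorial : R) * y ^ k := (ad_iter_pow_aux L x y hx hy k).2

lemma exists_hom {σ A : Type*} [Ring A] [Algebra ℂ A] (x : σ → A)
    (hx : ∀ i j, x i * x j = x j * x i) :
    ∃ Φ : MvPolynomial σ ℂ →ₐ[ℂ] A, ∀ i, Φ (MvPolynomial.X i) = x i := by
  have hc : ∀ a ∈ Set.range x, ∀ b ∈ Set.range x, a * b = b * a := by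
    rintro _ ⟨i, rfl⟩ _ ⟨j, rfl⟩; exact hx i j
  let inst : CommRing (Algebra.adjoin ℂ (Set.range x)) :=
    { (inferInstance : Ring (Algebra.adjoin ℂ (Set.range x))) with
      mul_comm := (Algebra.isMulCommutative_adjoin ℂ hc).is_comm.comm }
  refine ⟨(Algebra.adjoin ℂ (Set.range x)).val.comp (MvPolynomial.aeval
    (fun i => (⟨x i, Algebra.subset_adjoin ⟨i, rfl⟩⟩ : Algebra.adjoin ℂ (Set.range x)))), ?_⟩
  intro i
  simp

lemma X_pow_mem (N : ℕ) (i : Fin N) :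
    (MvPolynomial.X i : MvPolynomial (Fin N) ℂ) ^ N ∈
      Ideal.span {p | ∃ k, p = MvPolynomial.psum (Fin N) ℂ (k + 1)} := by
  set I := Ideal.span {p | ∃ k, p = MvPolynomial.psum (Fin N) ℂ (k + 1)} with hI
  have hps : ∀ k, 1 ≤ k → MvPolynomial.psum (Fin N) ℂ k ∈ I := by
    intro k hk
    obtain ⟨k, rfl⟩ := Nat.exists_eq_add_of_le' hk
    exact Ideal.subset_span ⟨k, rfl⟩
  have hes : ∀ k, 1 ≤ k → MvPolynomial.esymm (Fin N) ℂ k ∈ I := by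
    intro k hk
    have h := MvPolynomial.mul_esymm_eq_sum (Fin N) ℂ k
    have h1 : (k : MvPolynomial (Fin N) ℂ) * MvPolynomial.esymm (Fin N) ℂ k ∈ I := by
      rw [h]
      refine I.mul_mem_left _ (I.sum_mem fun a ha => I.mul_mem_left _ (hps _ ?_))
      have h1 := Finset.HasAntidiagonal.mem_antidiagonal.1 (Finset.mem_filter.1 ha).1
      have h2 := (Finset.mem_filter.1 ha).2
      omega
    have h2 := I.mul_mem_left (MvPolynomial.C ((k : ℂ)⁻¹)) h1
    rw [← mul_assoc, ← map_natCast (MvPolynomial.C : ℂ →+* MvPolynomial (Fin N) ℂ), ← map_mul,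
      inv_mul_cancel₀ (by exact_mod_cast (by omega : k ≠ 0)), map_one, one_mul] at h2
    exact h2
  have h := MvPolynomial.prod_C_add_X_eq_sum_esymm ℂ (Fin N)
  have h' := congrArg (Polynomial.eval (-MvPolynomial.X i)) h
  rw [Polynomial.eval_prod, Finset.prod_eq_zero (Finset.mem_univ i) (by simp),
    Polynomial.eval_finsetSum, Finset.sum_range_succ'] at h'
  simp only [Polynomial.eval_mul, Polynomial.eval_C, Polynomial.eval_pow, Polynomial.eval_X,
    MvPolynomial.esymm_zero, Fintype.card_fin, Nat.sub_zero] at h'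
  have h3 : (-MvPolynomial.X i : MvPolynomial (Fin N) ℂ) ^ N ∈ I := by
    have : (-MvPolynomial.X i : MvPolynomial (Fin N) ℂ) ^ N
      = - ∑ k ∈ Finset.range N, MvPolynomial.esymm (Fin N) ℂ (k + 1) *
        (-MvPolynomial.X i) ^ (N - (k + 1)) := by
      simp only [one_mul] at h'
      linear_combination -h'
    rw [this]
    exact I.neg_mem (I.sum_mem fun k _ => I.mul_mem_right _ (hes _ (by omega)))
  rw [neg_pow] at h3
  have := I.mul_mem_left ((-1) ^ N) h3
  rwa [← mul_assoc, ← mul_pow, neg_one_mul, neg_neg, one_pow, one_mul] at this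

/-- Partial derivative as a linear endomorphism. -/
noncomputable def pd {σ : Type*} (i : σ) : Module.End ℂ (MvPolynomial σ ℂ) :=
  (MvPolynomial.pderiv i).toLinearMap

/-- Multiplication as a linear endomorphism. -/
noncomputable def mu {σ : Type*} (p : MvPolynomial σ ℂ) : Module.End ℂ (MvPolynomial σ ℂ) :=
  LinearMap.mulLeft ℂ p

lemma pd_apply {σ : Type*} (i : σ) (p : MvPolynomial σ ℂ) :
    pd i p = MvPolynomial.pderiv i p := rfl

lemma mu_apply {σ : Type*} (q : MvPolynomial σ ℂ) (p : MvPolynomial σ ℂ) :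
    mu q p = q * p := rfl

lemma pd_comm {σ : Type*} (i j : σ) : pd i * pd j = pd j * pd i := by
  refine LinearMap.ext fun p => ?_
  ext n
  simp only [Module.End.mul_apply, pd_apply, MvPolynomial.coeff_pderiv]
  by_cases h : i = j
  · subst h; rfl
  · have h' : ¬ j = i := fun e => h e.symm
    have e1 : (Finsupp.single i 1 : σ →₀ ℕ) j = 0 := Finsupp.single_eq_of_ne h'
    have e2 : (Finsupp.single j 1 : σ →₀ ℕ) i = 0 := Finsupp.single_eq_of_ne h
    rw [add_right_comm n]
    simp only [Finsupp.coe_add, Pi.add_apply, e1, e2, add_zero]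
    ring

lemma pd_mu {σ : Type*} (i : σ) (p : MvPolynomial σ ℂ) :
    pd i * mu p = mu p * pd i + mu (MvPolynomial.pderiv i p) := by
  refine LinearMap.ext fun m => ?_
  simp only [Module.End.mul_apply, pd_apply, mu_apply, LinearMap.add_apply,
    MvPolynomial.pderiv_mul]
  ring

lemma pow_pd_eq_zero {N : ℕ} (p : MvPolynomial (Fin N) ℂ)
    (h : ∀ k : ℕ, (∑ i, pd i ^ (k + 1)) p = 0) (i : Fin N) : (pd i ^ N) p = 0 := by
  obtain ⟨Φ, hΦ⟩ := exists_hom (fun i : Fin N => pd i) pd_comm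
  have key : ∀ q ∈ Ideal.span {p | ∃ k, p = MvPolynomial.psum (Fin N) ℂ (k + 1)}, Φ q p = 0 := by
    intro q hq
    induction hq using Submodule.span_induction with
    | mem x hx =>
      obtain ⟨k, rfl⟩ := hx
      rw [MvPolynomial.psum, map_sum]
      simp only [map_pow, hΦ]
      exact h k
    | zero => simp
    | add x y _ _ hx hy => simp [hx, hy]
    | smul a x _ hx => simp [hx]
  have := key _ (X_pow_mem N i)
  rwa [map_pow, hΦ] at this

lemma coeff_of_pow_pd {σ : Type*} (i : σ) (k : ℕ) (p : MvPolynomial σ ℂ)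
    (h : (pd i ^ k) p = 0) (m : σ →₀ ℕ) (hm : k ≤ m i) : p.coeff m = 0 := by
  induction k generalizing p m with
  | zero => simp at h; simp [h]
  | succ k ih =>
    rw [pow_succ, Module.End.mul_apply] at h
    have h1 : m - Finsupp.single i 1 + Finsupp.single i 1 = m :=
      Finsupp.sub_add_single_one_cancel (by omega)
    have := ih _ h (m - Finsupp.single i 1) (by simp; omega)
    rw [pd_apply, MvPolynomial.coeff_pderiv, h1] at this
    rcases mul_eq_zero.1 this with h | h
    · exact h
    · exfalso; exact Nat.cast_add_one_ne_zero _ h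

/-- antisymmetric polynomials -/
def Anti {N : ℕ} (p : MvPolynomial (Fin N) ℂ) : Prop :=
  ∀ s : Equiv.Perm (Fin N), MvPolynomial.rename s p = ((Equiv.Perm.sign s : ℤ) : ℂ) • p

/-- The staircase exponent. -/
noncomputable def rho (N : ℕ) : Fin N →₀ ℕ := Finsupp.equivFunOnFinite.symm (fun i => (i : ℕ))

lemma rho_apply (N : ℕ) (i : Fin N) : rho N i = i := rfl

lemma anti_coeff {N : ℕ} {p : MvPolynomial (Fin N) ℂ} (hp : Anti p) (s : Equiv.Perm (Fin N))
    (m : Fin N →₀ ℕ) : p.coeff m = ((Equiv.Perm.sign s : ℤ) : ℂ) * p.coeff (m.mapDomain s) := by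
  have h := MvPolynomial.coeff_rename_mapDomain s s.injective p m
  rw [hp s, MvPolynomial.coeff_smul, smul_eq_mul] at h
  exact h.symm

lemma anti_eq_zero {N : ℕ} {p : MvPolynomial (Fin N) ℂ} (hp : Anti p)
    (hlt : ∀ m, p.coeff m ≠ 0 → ∀ i, m i < N) (h0 : p.coeff (rho N) = 0) : p = 0 := by
  ext m
  rw [MvPolynomial.coeff_zero]
  by_contra hm
  have hl := hlt m hm
  have hmd : ∀ (s : Equiv.Perm (Fin N)) i, m.mapDomain s (s i) = m i := fun s i =>
    Finsupp.mapDomain_apply s.injective m i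
  have hinj : Function.Injective (fun i => (⟨m i, hl i⟩ : Fin N)) := by
    intro i j hij
    by_contra hne
    simp only [Fin.mk.injEq] at hij
    have h := anti_coeff hp (Equiv.swap i j) m
    have : m.mapDomain (Equiv.swap i j) = m := by
      ext k
      have := hmd (Equiv.swap i j) (Equiv.swap i j k)
      rw [Equiv.swap_apply_self] at this
      rw [this]
      rcases eq_or_ne k i with rfl | hki
      · rw [Equiv.swap_apply_left, hij]
      rcases eq_or_ne k j with rfl | hkj
      · rw [Equiv.swap_apply_right, hij]
      rw [Equiv.swap_apply_of_ne_of_ne hki hkj]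
    rw [this, Equiv.Perm.sign_swap hne] at h
    simp only [Units.val_neg, Units.val_one, Int.cast_neg, Int.cast_one, neg_mul, one_mul] at h
    apply hm
    linear_combination h / 2
  have hbij := Finite.injective_iff_bijective.1 hinj
  let s := Equiv.ofBijective _ hbij
  have h := anti_coeff hp s m
  have : m.mapDomain s = rho N := by
    ext k
    obtain ⟨i, rfl⟩ := s.surjective k
    rw [hmd, rho_apply]
    rfl
  rw [this, h0, mul_zero] at h
  exact hm h

/-! ### The matrix side -/

/-- Half the Laplacian on matrices. -/
noncomputable def lapM (N : ℕ) : Module.End ℂ (MvPolynomial (Fin N × Fin N) ℂ) :=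
  (1 / 2 : ℂ) • ∑ a, ∑ b, pd (a, b) * pd (b, a)

/-- Half the Laplacian on vectors. -/
noncomputable def lapV (N : ℕ) : Module.End ℂ (MvPolynomial (Fin N) ℂ) :=
  (1 / 2 : ℂ) • ∑ a, pd a * pd a

/-- The generic matrix. -/
noncomputable def genM (N : ℕ) : Matrix (Fin N) (Fin N) (MvPolynomial (Fin N × Fin N) ℂ) :=
  Matrix.of fun i j => MvPolynomial.X (i, j)

/-- matrix of multiplications -/
noncomputable def MA (N : ℕ) :
    Matrix (Fin N) (Fin N) (Module.End ℂ (MvPolynomial (Fin N × Fin N) ℂ)) :=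
  Matrix.of fun i j => mu (MvPolynomial.X (i, j))

/-- matrix of derivatives -/
noncomputable def MD (N : ℕ) :
    Matrix (Fin N) (Fin N) (Module.End ℂ (MvPolynomial (Fin N × Fin N) ℂ)) :=
  Matrix.of fun i j => pd (j, i)

lemma ad_pd_mul_mu {σ : Type*} [DecidableEq σ] (s t u : σ) :
    (pd s * pd t) * mu (MvPolynomial.X u) - mu (MvPolynomial.X u) * (pd s * pd t)
      = (if t = u then pd s else 0) + (if s = u then pd t else 0) := by
  have h : ∀ s : σ, pd s * mu (MvPolynomial.X u) = mu (MvPolynomial.X u) * pd s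
      + (if s = u then 1 else 0) := by
    intro s
    rw [pd_mu]
    congr 1
    rw [MvPolynomial.pderiv_X]
    refine LinearMap.ext fun p => ?_
    by_cases h : s = u
    · subst h; simp [mu_apply]
    · rw [Pi.single_apply, if_neg (fun e => h e.symm), if_neg h]; simp [mu_apply]
  rw [mul_assoc, h t, mul_add, ← mul_assoc, h s]
  split_ifs <;> noncomm_ring

lemma ad_lapM_mu (N : ℕ) (i j : Fin N) :
    ad (lapM N) (mu (MvPolynomial.X (i, j))) = pd (j, i) := by
  have : ad (lapM N) (mu (MvPolynomial.X (i, j))) = (1 / 2 : ℂ) • ∑ a, ∑ b,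
      ((pd (a, b) * pd (b, a)) * mu (MvPolynomial.X (i, j))
        - mu (MvPolynomial.X (i, j)) * (pd (a, b) * pd (b, a))) := by
    simp only [ad, lapM, smul_mul_assoc, mul_smul_comm, Finset.sum_sub_distrib, smul_sub,
      Finset.sum_mul, Finset.mul_sum]
  rw [this]
  simp only [ad_pd_mul_mu, Prod.mk.injEq, Finset.sum_add_distrib, ite_and]
  simp only [Finset.sum_ite_eq', Finset.mem_univ, if_true, Finset.sum_ite_irrel,
    Finset.sum_const_zero]
  rw [← two_smul ℂ, smul_smul]
  norm_num

lemma ad_lapV_mu (N : ℕ) (i : Fin N) :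
    ad (lapV N) (mu (MvPolynomial.X i)) = pd i := by
  have : ad (lapV N) (mu (MvPolynomial.X i)) = (1 / 2 : ℂ) • ∑ a,
      ((pd a * pd a) * mu (MvPolynomial.X i)
        - mu (MvPolynomial.X i) * (pd a * pd a)) := by
    simp only [ad, lapV, smul_mul_assoc, mul_smul_comm, Finset.sum_sub_distrib, smul_sub,
      Finset.sum_mul, Finset.mul_sum]
  rw [this]
  simp only [ad_pd_mul_mu, Finset.sum_add_distrib]
  simp only [Finset.sum_ite_eq', Finset.mem_univ, if_true]
  rw [← two_smul ℂ, smul_smul]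
  norm_num

lemma ad_lapM_pd (N : ℕ) (s : Fin N × Fin N) : ad (lapM N) (pd s) = 0 := by
  have : ∀ a b : Fin N, pd (a, b) * pd (b, a) * pd s = pd s * (pd (a, b) * pd (b, a)) := by
    intro a b
    rw [mul_assoc, pd_comm (b, a) s, ← mul_assoc, pd_comm (a, b) s, mul_assoc]
  simp only [ad, lapM, smul_mul_assoc, mul_smul_comm, Finset.sum_mul, Finset.mul_sum, this,
    sub_self]

lemma ad_lapV_pd (N : ℕ) (s : Fin N) : ad (lapV N) (pd s) = 0 := by
  have : ∀ a : Fin N, pd a * pd a * pd s = pd s * (pd a * pd a) := by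
    intro a
    rw [mul_assoc, pd_comm a s, ← mul_assoc, pd_comm a s, mul_assoc]
  simp only [ad, lapV, smul_mul_assoc, mul_smul_comm, Finset.sum_mul, Finset.mul_sum, this,
    sub_self]

lemma ad_diag {n R : Type*} [Fintype n] [DecidableEq n] [Ring R] (L : R) (M : Matrix n n R) :
    ad (Matrix.diagonal fun _ => L) M = M.map (ad L) := by
  ext i j
  simp [ad, Matrix.diagonal_mul, Matrix.mul_diagonal]

lemma trace_ad_iter {n R : Type*} [Fintype n] [DecidableEq n] [Ring R] (L : R) (M : Matrix n n R)
    (k : ℕ) : ((ad (Matrix.diagonal fun _ => L))^[k] M).trace = (ad L)^[k] M.trace := by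
  induction k with
  | zero => rfl
  | succ k ih =>
    rw [Function.iterate_succ_apply', Function.iterate_succ_apply', ← ih, ad_diag]
    simp [Matrix.trace, ad, Finset.sum_sub_distrib, Finset.mul_sum, Finset.sum_mul]

lemma ad_iter_trace (N k : ℕ) :
    (ad (lapM N))^[k] ((MA N ^ k).trace) = (k.factorial : ℂ) • ((MD N) ^ k).trace := by
  rw [← trace_ad_iter, ad_iter_pow _ (MA N) (MD N)]
  · rw [← nsmul_eq_mul, Matrix.trace_smul, Nat.cast_smul_eq_nsmul]
  · rw [ad_diag]; ext1 i j; exact ad_lapM_mu N i j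
  · rw [ad_diag]; ext1 i j; exact ad_lapM_pd N _

lemma trace_MA (N k : ℕ) : (MA N ^ k).trace = mu (genM N ^ k).trace := by
  have h : MA N = (Algebra.lmul ℂ (MvPolynomial (Fin N × Fin N) ℂ)).toRingHom.mapMatrix (genM N) := by
    ext i j; rfl
  have h2 : ∀ p, mu p = (Algebra.lmul ℂ (MvPolynomial (Fin N × Fin N) ℂ)).toRingHom p :=
    fun _ => rfl
  rw [h, ← map_pow, h2]
  exact (AddMonoidHom.map_trace _ _).symm

lemma ad_add {R : Type*} [Ring R] (L u v : R) : ad L (u + v) = ad L u + ad L v := by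
  simp only [ad]; noncomm_ring

lemma ad_iter_sum {R ι : Type*} [Ring R] (L : R) (s : Finset ι) (f : ι → R) (k : ℕ) :
    (ad L)^[k] (∑ i ∈ s, f i) = ∑ i ∈ s, (ad L)^[k] (f i) := by
  induction k with
  | zero => rfl
  | succ k ih =>
    rw [Function.iterate_succ_apply', ih]
    simp only [Function.iterate_succ_apply']
    simp [ad, Finset.sum_sub_distrib, Finset.mul_sum, Finset.sum_mul]

lemma ad_iter_psum (N k : ℕ) :
    (ad (lapV N))^[k] (mu (∑ i, MvPolynomial.X i ^ k)) = (k.factorial : ℂ) • ∑ i, pd i ^ k := by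
  have h2 : ∀ p, mu p = (Algebra.lmul ℂ (MvPolynomial (Fin N) ℂ)) p := fun _ => rfl
  rw [h2, map_sum, ad_iter_sum, Finset.smul_sum]
  refine Finset.sum_congr rfl fun i _ => ?_
  rw [map_pow, ← h2, ad_iter_pow _ _ _ (ad_lapV_mu N i) (ad_lapV_pd N i), ← nsmul_eq_mul,
    Nat.cast_smul_eq_nsmul]

/-- infinitesimal conjugation -/
noncomputable def xi {N : ℕ} (i j : Fin N) :
    Derivation ℂ (MvPolynomial (Fin N × Fin N) ℂ) (MvPolynomial (Fin N × Fin N) ℂ) :=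
  ∑ k, ((MvPolynomial.X (j, k) : MvPolynomial (Fin N × Fin N) ℂ) • MvPolynomial.pderiv (i, k)
    - (MvPolynomial.X (k, i) : MvPolynomial (Fin N × Fin N) ℂ) • MvPolynomial.pderiv (k, j))

lemma xi_apply {N : ℕ} (i j : Fin N) (f : MvPolynomial (Fin N × Fin N) ℂ) :
    xi i j f = ∑ k, (MvPolynomial.X (j, k) * MvPolynomial.pderiv (i, k) f
      - MvPolynomial.X (k, i) * MvPolynomial.pderiv (k, j) f) := by
  have h := congrFun (map_sum (Derivation.coeFnAddMonoidHom (R := ℂ)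
    (A := MvPolynomial (Fin N × Fin N) ℂ) (M := MvPolynomial (Fin N × Fin N) ℂ))
    (fun k => ((MvPolynomial.X (j, k) : MvPolynomial (Fin N × Fin N) ℂ) • MvPolynomial.pderiv (i, k)
    - (MvPolynomial.X (k, i) : MvPolynomial (Fin N × Fin N) ℂ) • MvPolynomial.pderiv (k, j)))
    Finset.univ) f
  rw [Finset.sum_apply] at h
  exact h

lemma xi_X {N : ℕ} (i j k l : Fin N) :
    xi i j (MvPolynomial.X (k, l)) =
      (Matrix.single i j 1 * genM N - genM N * Matrix.single i j 1 :
        Matrix (Fin N) (Fin N) (MvPolynomial (Fin N × Fin N) ℂ)) k l := by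
  rw [xi_apply]
  simp only [MvPolynomial.pderiv_X, Pi.single_apply, Prod.mk.injEq, Finset.sum_sub_distrib,
    mul_ite, mul_one, mul_zero, ite_and, Matrix.sub_apply, Matrix.mul_apply, Matrix.single_apply,
    ite_mul, one_mul, zero_mul, genM, Matrix.of_apply]
  simp only [Finset.sum_ite_irrel, Finset.sum_ite_eq, Finset.sum_const_zero, Finset.mem_univ,
    if_true, eq_comm]

lemma xi_pow {N : ℕ} (i j : Fin N) (m : ℕ) :
    (genM N ^ m).map (xi i j) = Matrix.single i j 1 * genM N ^ m - genM N ^ m * Matrix.single i j 1 := by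
  have hmul : ∀ A B : Matrix (Fin N) (Fin N) (MvPolynomial (Fin N × Fin N) ℂ),
      (A * B).map (xi i j) = A.map (xi i j) * B + A * B.map (xi i j) := by
    intro A B
    ext1 k l
    simp only [Matrix.map_apply, Matrix.mul_apply, Matrix.add_apply, map_sum, Derivation.leibniz,
      smul_eq_mul, Finset.sum_add_distrib]
    rw [add_comm]
    congr 1
    exact Finset.sum_congr rfl fun _ _ => mul_comm _ _
  have h1 : (genM N).map (xi i j) = Matrix.single i j 1 * genM N - genM N * Matrix.single i j 1 := by
    ext1 k l; exact xi_X i j k l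
  induction m with
  | zero =>
    ext1 k l
    rw [pow_zero, Matrix.map_apply, Matrix.one_apply]
    split_ifs <;> simp
  | succ m ih =>
    rw [pow_succ, hmul, ih, h1]
    noncomm_ring

lemma xi_trace {N : ℕ} (i j : Fin N) (m : ℕ) : xi i j (genM N ^ m).trace = 0 := by
  have h := congrArg Matrix.trace (xi_pow i j m)
  rw [Matrix.trace_sub, Matrix.trace_mul_comm, sub_self] at h
  rw [← h, Matrix.trace, Matrix.trace, map_sum]
  rfl

lemma pd_xi {N : ℕ} (a b i j : Fin N) (f : MvPolynomial (Fin N × Fin N) ℂ) :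
    pd (a, b) (xi i j f) = xi i j (pd (a, b) f) + (if j = a then pd (i, b) f else 0)
      - (if b = i then pd (a, j) f else 0) := by
  have hc : ∀ s t : Fin N × Fin N, MvPolynomial.pderiv s (MvPolynomial.pderiv t f)
      = MvPolynomial.pderiv t (MvPolynomial.pderiv s f) := by
    intro s t
    exact LinearMap.congr_fun (pd_comm s t) f
  rw [xi_apply, xi_apply, map_sum, ← add_sub_assoc' , ← sub_eq_iff_eq_add', ← Finset.sum_sub_distrib]
  have : ∀ k, pd (a, b) (MvPolynomial.X (j, k) * MvPolynomial.pderiv (i, k) f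
      - MvPolynomial.X (k, i) * MvPolynomial.pderiv (k, j) f)
      - (MvPolynomial.X (j, k) * MvPolynomial.pderiv (i, k) (pd (a, b) f)
      - MvPolynomial.X (k, i) * MvPolynomial.pderiv (k, j) (pd (a, b) f))
      = (if j = a then (if k = b then pd (i, k) f else 0) else 0)
       - (if k = a then (if i = b then pd (k, j) f else 0) else 0) := by
    intro k
    simp only [pd_apply, map_sub, MvPolynomial.pderiv_mul, hc (a, b), MvPolynomial.pderiv_X,
      Pi.single_apply, Prod.mk.injEq, ite_and, ite_mul, one_mul, zero_mul]
    ring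
  rw [Finset.sum_congr rfl fun k _ => this k, Finset.sum_sub_distrib]
  simp only [Finset.sum_ite_irrel, Finset.sum_ite_eq', Finset.sum_const_zero, Finset.mem_univ,
    if_true, eq_comm (a := i) (b := b)]

lemma lapM_xi {N : ℕ} (i j : Fin N) (f : MvPolynomial (Fin N × Fin N) ℂ) :
    lapM N (xi i j f) = xi i j (lapM N f) := by
  have hc : ∀ s t : Fin N × Fin N, pd s (pd t f) = pd t (pd s f) := by
    intro s t
    exact LinearMap.congr_fun (pd_comm s t) f
  simp only [lapM, LinearMap.smul_apply, LinearMap.sum_apply, Module.End.mul_apply,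
    Derivation.map_smul, map_sum]
  congr 1
  rw [← sub_eq_zero, ← Finset.sum_sub_distrib]
  simp only [← Finset.sum_sub_distrib]
  have : ∀ a b : Fin N, pd (a, b) (pd (b, a) (xi i j f)) - xi i j (pd (a, b) (pd (b, a) f))
     = (if j = a then pd (b, a) (pd (i, b) f) else 0) - (if b = i then pd (b, a) (pd (a, j) f) else 0)
      + ((if j = b then pd (a, b) (pd (i, a) f) else 0)
        - (if a = i then pd (a, b) (pd (b, j) f) else 0)) := by
    intro a b
    rw [pd_xi b a, map_sub, map_add, pd_xi a b, apply_ite (pd (a, b)), apply_ite (pd (a, b)),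
      hc (b, a) (i, b), hc (b, a) (a, j), map_zero]
    ring
  simp only [this, Finset.sum_add_distrib, Finset.sum_sub_distrib]
  rw [Finset.sum_comm]
  simp only [Finset.sum_ite_irrel, Finset.sum_ite_eq, Finset.sum_ite_eq', Finset.sum_const_zero,
    Finset.mem_univ, if_true]
  rw [Finset.sum_congr rfl fun b _ => hc (b, j) (i, b)]
  ring

/-! ### The radial part -/

/-- The Vandermonde polynomial. -/
noncomputable def vdm (N : ℕ) : MvPolynomial (Fin N) ℂ :=
  (Matrix.vandermonde (fun i : Fin N => (MvPolynomial.X i : MvPolynomial (Fin N) ℂ))).det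

lemma mapDomain_perm_apply {N : ℕ} (s : Equiv.Perm (Fin N)) (m : Fin N →₀ ℕ) (i : Fin N) :
    m.mapDomain s (s i) = m i := Finsupp.mapDomain_apply s.injective m i

lemma vdm_eq (N : ℕ) : vdm N = ∑ s : Equiv.Perm (Fin N), ((Equiv.Perm.sign s : ℤ) : ℂ) •
    MvPolynomial.monomial ((rho N).mapDomain s) (1 : ℂ) := by
  rw [vdm, Matrix.det_apply]
  refine Finset.sum_congr rfl fun s _ => ?_
  have : ∏ i, Matrix.vandermonde (fun i : Fin N => (MvPolynomial.X i : MvPolynomial (Fin N) ℂ)) (s i) i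
      = MvPolynomial.monomial ((rho N).mapDomain s) (1 : ℂ) := by
    rw [MvPolynomial.monomial_eq, Finsupp.prod_fintype _ _ (by simp), map_one, one_mul]
    conv_rhs => rw [← Equiv.prod_comp s]
    refine Finset.prod_congr rfl fun i _ => ?_
    rw [mapDomain_perm_apply, rho_apply, Matrix.vandermonde_apply]
  rw [this, Units.smul_def, Int.cast_smul_eq_zsmul]

lemma vdm_coeff {N : ℕ} {m : Fin N →₀ ℕ} (h : (vdm N).coeff m ≠ 0) :
    ∃ s : Equiv.Perm (Fin N), m = (rho N).mapDomain s := by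
  by_contra! hc
  apply h
  rw [vdm_eq, MvPolynomial.coeff_sum]
  refine Finset.sum_eq_zero fun s _ => ?_
  rw [MvPolynomial.coeff_smul, MvPolynomial.coeff_monomial, if_neg (fun e => hc s e.symm), smul_zero]

lemma sum_mapDomain {N : ℕ} (s : Equiv.Perm (Fin N)) (m : Fin N →₀ ℕ) :
    ∑ i, m.mapDomain s i = ∑ i, m i := by
  rw [← Equiv.sum_comp s]
  simp [mapDomain_perm_apply]

lemma vdm_coeff_lt {N : ℕ} {m : Fin N →₀ ℕ} (h : (vdm N).coeff m ≠ 0) (i : Fin N) : m i < N := by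
  obtain ⟨s, rfl⟩ := vdm_coeff h
  obtain ⟨j, rfl⟩ := s.surjective i
  rw [mapDomain_perm_apply, rho_apply]
  exact j.2

lemma vdm_coeff_sum {N : ℕ} {m : Fin N →₀ ℕ} (h : (vdm N).coeff m ≠ 0) :
    ∑ i, m i = ∑ i, rho N i := by
  obtain ⟨s, rfl⟩ := vdm_coeff h
  exact sum_mapDomain s _

lemma vdm_coeff_rho (N : ℕ) : (vdm N).coeff (rho N) = 1 := by
  rw [vdm_eq, MvPolynomial.coeff_sum, Finset.sum_eq_single 1]
  · have : (rho N).mapDomain (1 : Equiv.Perm (Fin N)) = rho N := by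
      rw [Equiv.Perm.coe_one, Finsupp.mapDomain_id]
    rw [this]; simp
  · intro s _ hs
    rw [MvPolynomial.coeff_smul, MvPolynomial.coeff_monomial, if_neg, smul_zero]
    intro e
    apply hs
    ext i
    have := mapDomain_perm_apply s (rho N) i
    rw [e] at this
    exact this
  · simp

lemma vdm_anti (N : ℕ) : Anti (vdm N) := by
  intro s
  rw [vdm, AlgHom.map_det]
  have : (MvPolynomial.rename s : _ →ₐ[ℂ] MvPolynomial (Fin N) ℂ).mapMatrix
      (Matrix.vandermonde fun i : Fin N => (MvPolynomial.X i : MvPolynomial (Fin N) ℂ))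
      = (Matrix.vandermonde fun i : Fin N => (MvPolynomial.X i : MvPolynomial (Fin N) ℂ)).submatrix s id := by
    ext1 i j
    simp [Matrix.vandermonde_apply]
  rw [this, Matrix.det_permute, Int.cast_smul_eq_zsmul, zsmul_eq_mul]

lemma rename_lapV {N : ℕ} (s : Equiv.Perm (Fin N)) (p : MvPolynomial (Fin N) ℂ) :
    MvPolynomial.rename s (lapV N p) = lapV N (MvPolynomial.rename s p) := by
  simp only [lapV, LinearMap.smul_apply, LinearMap.sum_apply, Module.End.mul_apply, map_smul,
    map_sum, pd_apply]
  congr 1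
  conv_rhs => rw [← Equiv.sum_comp s]
  refine Finset.sum_congr rfl fun i _ => ?_
  rw [MvPolynomial.pderiv_rename s.injective, MvPolynomial.pderiv_rename s.injective]

lemma lapV_vdm (N : ℕ) : lapV N (vdm N) = 0 := by
  have hco : ∀ m, (lapV N (vdm N)).coeff m ≠ 0 → ∃ i,
      (vdm N).coeff (m + Finsupp.single i 1 + Finsupp.single i 1) ≠ 0 := by
    intro m hm
    by_contra! hc
    apply hm
    simp only [lapV, LinearMap.smul_apply, LinearMap.sum_apply, Module.End.mul_apply, pd_apply,
      MvPolynomial.coeff_smul, MvPolynomial.coeff_sum, MvPolynomial.coeff_pderiv, hc]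
    simp
  apply anti_eq_zero
  · intro s
    rw [rename_lapV, vdm_anti, map_smul]
  · intro m hm i
    obtain ⟨j, hj⟩ := hco m hm
    have := vdm_coeff_lt hj i
    simp only [Finsupp.add_apply] at this
    omega
  · by_contra hm
    obtain ⟨j, hj⟩ := hco _ hm
    have := vdm_coeff_sum hj
    simp only [Finsupp.add_apply, Finset.sum_add_distrib] at this
    have h1 : ∑ i, (Finsupp.single j 1 : Fin N →₀ ℕ) i = 1 := by
      simp [Finsupp.single_apply]
    omega

lemma vdm_prod (N : ℕ) : vdm N = ∏ p ∈ (Finset.univ : Finset (Fin N × Fin N)).filter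
    (fun p => p.1 < p.2), (MvPolynomial.X p.2 - MvPolynomial.X p.1) := by
  rw [vdm, Matrix.det_vandermonde, Finset.prod_filter, ← Finset.univ_product_univ,
    Finset.prod_product]
  refine Finset.prod_congr rfl fun i _ => ?_
  rw [← Finset.prod_filter]
  congr 1
  ext j; simp

lemma grad_prod {N : ℕ} (s : Finset (Fin N × Fin N)) (φ : MvPolynomial (Fin N) ℂ)
    (g : Fin N × Fin N → MvPolynomial (Fin N) ℂ)
    (hg : ∀ p ∈ s, (MvPolynomial.X p.2 - MvPolynomial.X p.1) * g p
      = MvPolynomial.pderiv p.2 φ - MvPolynomial.pderiv p.1 φ) :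
    ∑ k, MvPolynomial.pderiv k (∏ p ∈ s, (MvPolynomial.X p.2 - MvPolynomial.X p.1))
      * MvPolynomial.pderiv k φ
      = (∏ p ∈ s, (MvPolynomial.X p.2 - MvPolynomial.X p.1)) * ∑ p ∈ s, g p := by
  induction s using Finset.induction_on with
  | empty => simp
  | insert q s hq ih =>
    have ih := ih fun p hp => hg p (Finset.mem_insert_of_mem hp)
    have h1 := hg q (Finset.mem_insert_self _ _)
    simp only [Finset.prod_insert hq, Finset.sum_insert hq, MvPolynomial.pderiv_mul, map_sub,
      add_mul, Finset.sum_add_distrib, mul_assoc, ← Finset.mul_sum, ih]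
    simp only [sub_mul, Finset.sum_sub_distrib, MvPolynomial.pderiv_X, Pi.single_apply, ite_mul,
      one_mul, zero_mul, Finset.sum_ite_eq, Finset.mem_univ, if_true]
    linear_combination (- ∏ p ∈ s, (MvPolynomial.X p.2 - MvPolynomial.X p.1)) * h1

lemma lapV_mul {N : ℕ} (p q : MvPolynomial (Fin N) ℂ) :
    lapV N (p * q) = p * lapV N q + ∑ k, MvPolynomial.pderiv k p * MvPolynomial.pderiv k q
      + lapV N p * q := by
  have h : ∀ k, pd k (pd k (p * q)) = p * pd k (pd k q)
      + (2 : ℂ) • (MvPolynomial.pderiv k p * MvPolynomial.pderiv k q) + pd k (pd k p) * q := by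
    intro k
    simp only [pd_apply, MvPolynomial.pderiv_mul, map_add, two_smul]
    ring
  simp only [lapV, LinearMap.smul_apply, LinearMap.sum_apply, Module.End.mul_apply, h]
  rw [Finset.sum_add_distrib, Finset.sum_add_distrib, ← Finset.mul_sum, ← Finset.sum_mul,
    ← Finset.smul_sum, smul_add, smul_add, smul_smul, mul_smul_comm, smul_mul_assoc]
  norm_num

/-- Restriction to diagonal matrices. -/
noncomputable def res (N : ℕ) : MvPolynomial (Fin N × Fin N) ℂ →ₐ[ℂ] MvPolynomial (Fin N) ℂ :=
  MvPolynomial.aeval (fun p => if p.1 = p.2 then MvPolynomial.X p.1 else 0)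

lemma res_X {N : ℕ} (i j : Fin N) :
    res N (MvPolynomial.X (i, j)) = if i = j then MvPolynomial.X i else 0 := by
  simp [res]

lemma pderiv_res {N : ℕ} (k : Fin N) (f : MvPolynomial (Fin N × Fin N) ℂ) :
    MvPolynomial.pderiv k (res N f) = res N (MvPolynomial.pderiv (k, k) f) := by
  induction f using MvPolynomial.induction_on with
  | C a => simp [res]
  | add p q hp hq => simp [hp, hq]
  | mul_X p a h =>
    obtain ⟨i, j⟩ := a
    rw [map_mul, MvPolynomial.pderiv_mul, MvPolynomial.pderiv_mul, h, map_add, map_mul, map_mul,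
      res_X]
    congr 2
    rw [MvPolynomial.pderiv_X]
    by_cases hij : i = j
    · subst hij
      simp only [if_true, MvPolynomial.pderiv_X, Pi.single_apply, Prod.mk.injEq, and_self]
      split_ifs <;> simp
    · rw [if_neg hij, map_zero, Pi.single_apply, if_neg, map_zero]
      simp only [Prod.mk.injEq]
      rintro ⟨rfl, rfl⟩; exact hij rfl

/-- Infinitesimally conjugation invariant polynomials. -/
def Inv {N : ℕ} (f : MvPolynomial (Fin N × Fin N) ℂ) : Prop := ∀ i j, i ≠ j → xi i j f = 0

lemma res_xi {N : ℕ} (i j : Fin N) (g : MvPolynomial (Fin N × Fin N) ℂ) :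
    res N (xi i j g) = (MvPolynomial.X j - MvPolynomial.X i) * res N (MvPolynomial.pderiv (i, j) g) := by
  rw [xi_apply, map_sum]
  simp only [map_sub, map_mul, res_X, Finset.sum_sub_distrib, ite_mul, zero_mul]
  simp only [Finset.sum_ite_eq, Finset.sum_ite_eq', Finset.mem_univ, if_true]
  ring

lemma inv_res {N : ℕ} {f : MvPolynomial (Fin N × Fin N) ℂ} (hf : Inv f) (i j : Fin N) (hij : i ≠ j) :
    (MvPolynomial.X j - MvPolynomial.X i) * res N (pd (i, j) (pd (j, i) f))
      = MvPolynomial.pderiv j (res N f) - MvPolynomial.pderiv i (res N f) := by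
  have h := congrArg (res N) (pd_xi j i i j f)
  rw [hf i j hij] at h
  simp only [if_true, map_sub, map_add, map_zero] at h
  rw [res_xi] at h
  rw [pderiv_res, pderiv_res]
  simp only [pd_apply] at *
  linear_combination -h

/-- The radial map. -/
noncomputable def rad (N : ℕ) : MvPolynomial (Fin N × Fin N) ℂ →ₗ[ℂ] MvPolynomial (Fin N) ℂ :=
  (mu (vdm N)) ∘ₗ (res N).toLinearMap

lemma rad_apply {N : ℕ} (f : MvPolynomial (Fin N × Fin N) ℂ) : rad N f = vdm N * res N f := rfl

lemma rad_lap {N : ℕ} {f : MvPolynomial (Fin N × Fin N) ℂ} (hf : Inv f) :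
    rad N (lapM N f) = lapV N (rad N f) := by
  rw [rad_apply, rad_apply, lapV_mul, lapV_vdm, zero_mul, add_zero]
  have hg := grad_prod ((Finset.univ : Finset (Fin N × Fin N)).filter
    (fun p => p.1 < p.2)) (res N f) (fun p => res N (pd (p.1, p.2) (pd (p.2, p.1) f)))
    (fun p hp => inv_res hf _ _ (ne_of_lt (Finset.mem_filter.1 hp).2))
  rw [← vdm_prod] at hg
  rw [hg, ← mul_add]
  congr 1
  simp only [lapM, lapV, LinearMap.smul_apply, LinearMap.sum_apply, Module.End.mul_apply, map_smul,
    map_sum]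
  have hsplit : ∀ h : Fin N → Fin N → MvPolynomial (Fin N) ℂ, (∀ a b, h a b = h b a) →
      ∑ a, ∑ b, h a b = ∑ a, h a a + (2 : ℂ) • ∑ p ∈ (Finset.univ : Finset (Fin N × Fin N)).filter
        (fun p => p.1 < p.2), h p.1 p.2 := by
    intro h hs
    have e : ∀ a b, h a b = (if a = b then h a b else 0) + (if a < b then h a b else 0)
        + (if b < a then h b a else 0) := by
      intro a b
      rcases lt_trichotomy a b with hl | hl | hl
      · simp [hl, hl.ne, hl.not_gt]
      · simp [hl]
      · simp [hl, hl.ne', hl.not_gt, hs a b]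
    have e2 : ∑ p ∈ (Finset.univ : Finset (Fin N × Fin N)).filter
        (fun p => p.1 < p.2), h p.1 p.2 = ∑ a, ∑ b, if a < b then h a b else 0 := by
      rw [Finset.sum_filter, ← Finset.univ_product_univ, Finset.sum_product]
    rw [e2, Finset.sum_congr rfl fun a _ => Finset.sum_congr rfl fun b _ => e a b]
    simp only [Finset.sum_add_distrib]
    rw [two_smul, Finset.sum_comm (f := fun a b => if b < a then h b a else 0)]
    simp [add_assoc]
  rw [hsplit _ (fun a b => by
    have := LinearMap.congr_fun (pd_comm (a, b) (b, a)) f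
    exact congrArg (res N) this), smul_add, smul_smul]
  norm_num
  refine Finset.sum_congr rfl fun a _ => ?_
  simp only [pd_apply, pderiv_res]

/-- intertwining relation -/
def Itw {N : ℕ} (T : Module.End ℂ (MvPolynomial (Fin N × Fin N) ℂ))
    (T' : Module.End ℂ (MvPolynomial (Fin N) ℂ)) : Prop :=
  ∀ f, Inv f → Inv (T f) ∧ rad N (T f) = T' (rad N f)

lemma itw_ad {N : ℕ} {L T : Module.End ℂ (MvPolynomial (Fin N × Fin N) ℂ)}
    {L' T' : Module.End ℂ (MvPolynomial (Fin N) ℂ)} (h1 : Itw L L') (h2 : Itw T T') :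
    Itw (ad L T) (ad L' T') := by
  intro f hf
  have a1 := h1 f hf
  have a2 := h2 f hf
  have b1 := h1 _ a2.1
  have b2 := h2 _ a1.1
  constructor
  · intro i j hij
    simp only [ad, LinearMap.sub_apply, Module.End.mul_apply, map_sub]
    rw [b1.1 i j hij, b2.1 i j hij, sub_self]
  · simp only [ad, LinearMap.sub_apply, Module.End.mul_apply, map_sub]
    rw [b1.2, b2.2, a1.2, a2.2]

lemma itw_ad_iter {N : ℕ} {L T : Module.End ℂ (MvPolynomial (Fin N × Fin N) ℂ)}
    {L' T' : Module.End ℂ (MvPolynomial (Fin N) ℂ)} (h1 : Itw L L') (h2 : Itw T T') (k : ℕ) :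
    Itw ((ad L)^[k] T) ((ad L')^[k] T') := by
  induction k with
  | zero => exact h2
  | succ k ih =>
    rw [Function.iterate_succ_apply', Function.iterate_succ_apply']
    exact itw_ad h1 ih

lemma itw_lap (N : ℕ) : Itw (lapM N) (lapV N) := by
  intro f hf
  refine ⟨fun i j hij => ?_, rad_lap hf⟩
  rw [← lapM_xi, hf i j hij, map_zero]

lemma res_trace (N k : ℕ) : res N (genM N ^ k).trace = ∑ i, MvPolynomial.X i ^ k := by
  have h : (res N).mapMatrix (genM N) = Matrix.diagonal (fun i => MvPolynomial.X i) := by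
    ext1 i j
    rw [Matrix.diagonal_apply]
    exact res_X i j
  have : res N (genM N ^ k).trace = ((res N).mapMatrix (genM N ^ k)).trace :=
    AddMonoidHom.map_trace (res N) _
  rw [this, map_pow, h, Matrix.diagonal_pow, Matrix.trace_diagonal]
  rfl

lemma itw_trace (N k : ℕ) : Itw (mu (genM N ^ k).trace) (mu (∑ i, MvPolynomial.X i ^ k)) := by
  intro f hf
  constructor
  · intro i j hij
    rw [mu_apply, Derivation.leibniz, hf i j hij, xi_trace, smul_zero, smul_zero, add_zero]
  · rw [mu_apply, mu_apply, rad_apply, rad_apply, map_mul, res_trace]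
    ring

/-- The Harish-Chandra radial part formula for power sums. -/
lemma rad_psum {N : ℕ} (k : ℕ) {f : MvPolynomial (Fin N × Fin N) ℂ} (hf : Inv f) :
    rad N ((MD N ^ k).trace f) = (∑ i, pd i ^ k) (rad N f) := by
  have h := (itw_ad_iter (itw_lap N) (itw_trace N k) k f hf).2
  rw [← trace_MA, ad_iter_trace, ad_iter_psum, LinearMap.smul_apply, LinearMap.smul_apply,
    map_smul] at h
  exact smul_right_injective _ (by exact_mod_cast k.factorial_ne_zero : (k.factorial : ℂ) ≠ 0) h

/-! ### Divided powers and coefficientwise integration -/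

/-- Divided powers, indexed by integers. -/
noncomputable def dp {S : Type*} [CommRing S] [Algebra ℂ S] (x : S) (z : ℤ) : S :=
  if z < 0 then 0 else ((z.toNat.factorial : ℂ)⁻¹) • x ^ z.toNat

lemma dp_neg {S : Type*} [CommRing S] [Algebra ℂ S] (x : S) {z : ℤ} (h : z < 0) : dp x z = 0 := by
  simp [dp, h]

lemma dp_nat {S : Type*} [CommRing S] [Algebra ℂ S] (x : S) (n : ℕ) :
    dp x (n : ℤ) = ((n.factorial : ℂ)⁻¹) • x ^ n := by
  simp [dp]

lemma map_dp {S T : Type*} [CommRing S] [Algebra ℂ S] [CommRing T] [Algebra ℂ T]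
    (f : S →ₐ[ℂ] T) (x : S) (z : ℤ) : f (dp x z) = dp (f x) z := by
  unfold dp
  split_ifs <;> simp

lemma pderiv_dp {σ R : Type*} [CommRing R] [Algebra ℂ R] (i : σ) (x : MvPolynomial σ R) (z : ℤ) :
    MvPolynomial.pderiv i (dp x z) = dp x (z - 1) * MvPolynomial.pderiv i x := by
  rcases lt_or_ge z 0 with h | h
  · rw [dp_neg x h, dp_neg x (by omega), map_zero, zero_mul]
  obtain ⟨n, rfl⟩ := Int.eq_ofNat_of_zero_le h
  have hs : ∀ (c : ℂ) (p : MvPolynomial σ R), MvPolynomial.pderiv i (c • p)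
      = c • MvPolynomial.pderiv i p := fun c p =>
    LinearMap.map_smul_of_tower (MvPolynomial.pderiv i).toLinearMap c p
  rcases n with _ | n
  · rw [dp_nat, dp_neg x (by simp), hs]
    simp
  · have : ((n + 1 : ℕ) : ℤ) - 1 = (n : ℤ) := by push_cast; ring
    rw [this, dp_nat, dp_nat, hs, MvPolynomial.pderiv_pow, Nat.add_sub_cancel, mul_assoc,
      ← nsmul_eq_mul, ← Nat.cast_smul_eq_nsmul ℂ, smul_smul, smul_mul_assoc]
    congr 1
    rw [Nat.factorial_succ]
    have : (n.factorial : ℂ) ≠ 0 := by exact_mod_cast n.factorial_ne_zero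
    have : ((n : ℂ) + 1) ≠ 0 := by exact_mod_cast n.succ_ne_zero
    push_cast
    field_simp

/-- Apply a linear functional to all coefficients. -/
noncomputable def J {σ R : Type*} [CommRing R] [Algebra ℂ R] (I : R →ₗ[ℂ] ℂ)
    (P : MvPolynomial σ R) : MvPolynomial σ ℂ := AddMonoidAlgebra.map I.toAddMonoidHom P

lemma coeff_J {σ R : Type*} [CommRing R] [Algebra ℂ R] (I : R →ₗ[ℂ] ℂ) (P : MvPolynomial σ R)
    (m : σ →₀ ℕ) : (J I P).coeff m = I (P.coeff m) := rfl

lemma J_sum {σ R ι : Type*} [CommRing R] [Algebra ℂ R] (I : R →ₗ[ℂ] ℂ) (s : Finset ι)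
    (P : ι → MvPolynomial σ R) : J I (∑ i ∈ s, P i) = ∑ i ∈ s, J I (P i) := by
  ext m
  simp [coeff_J, MvPolynomial.coeff_sum]

lemma J_add {σ R : Type*} [CommRing R] [Algebra ℂ R] (I : R →ₗ[ℂ] ℂ)
    (P Q : MvPolynomial σ R) : J I (P + Q) = J I P + J I Q := by
  ext m
  simp [coeff_J]

lemma J_C_algebraMap {σ R : Type*} [CommRing R] [Algebra ℂ R] (I : R →ₗ[ℂ] ℂ) (c : ℂ)
    (P : MvPolynomial σ R) : J I (MvPolynomial.C (algebraMap ℂ R c) * P) = c • J I P := by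
  ext m
  rw [coeff_J, MvPolynomial.coeff_C_mul, MvPolynomial.coeff_smul, coeff_J, ← Algebra.smul_def,
    map_smul]

lemma pderiv_J {σ R : Type*} [CommRing R] [Algebra ℂ R] (I : R →ₗ[ℂ] ℂ) (P : MvPolynomial σ R)
    (i : σ) : MvPolynomial.pderiv i (J I P) = J I (MvPolynomial.pderiv i P) := by
  ext m
  rw [coeff_J, MvPolynomial.coeff_pderiv, MvPolynomial.coeff_pderiv, coeff_J]
  have : ((m i : R) + 1) = ((m i + 1 : ℕ) : R) := by push_cast; rfl
  rw [this, mul_comm _ ((m i + 1 : ℕ) : R), ← nsmul_eq_mul, map_nsmul, nsmul_eq_mul]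
  push_cast
  ring

lemma eval_J {σ R : Type*} [CommRing R] [Algebra ℂ R] (I : R →ₗ[ℂ] ℂ) (P : MvPolynomial σ R)
    (A : σ → ℂ) : MvPolynomial.eval A (J I P)
      = I (MvPolynomial.eval (fun s => algebraMap ℂ R (A s)) P) := by
  induction P using MvPolynomial.induction_on' with
  | add p q hp hq => rw [J_add, map_add, map_add, hp, hq, map_add]
  | monomial m r =>
    classical
    have : J I (MvPolynomial.monomial m r) = MvPolynomial.monomial m (I r) := by
      ext n
      rw [coeff_J, MvPolynomial.coeff_monomial, MvPolynomial.coeff_monomial]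
      split_ifs <;> simp
    rw [this, MvPolynomial.eval_monomial, MvPolynomial.eval_monomial]
    simp only [Finsupp.prod, ← map_pow]
    rw [← map_prod, mul_comm r, ← Algebra.smul_def, map_smul, smul_eq_mul, mul_comm]

/-- `Tr(A X)` with generic `A`. -/
noncomputable def trAX {N : ℕ} {R : Type*} [CommRing R] (X : Matrix (Fin N) (Fin N) R) :
    MvPolynomial (Fin N × Fin N) R :=
  ∑ i, ∑ j, MvPolynomial.C (X j i) * MvPolynomial.X (i, j)

lemma pderiv_trAX {N : ℕ} {R : Type*} [CommRing R] (X : Matrix (Fin N) (Fin N) R) (k l : Fin N) :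
    MvPolynomial.pderiv (k, l) (trAX X) = MvPolynomial.C (X l k) := by
  simp only [trAX, map_sum, MvPolynomial.pderiv_C_mul, MvPolynomial.pderiv_X, Pi.single_apply,
    Prod.mk.injEq, ite_and, mul_ite, mul_one, mul_zero]
  simp only [Finset.sum_ite_irrel, Finset.sum_ite_eq', Finset.sum_const_zero, Finset.mem_univ,
    if_true]

lemma MD_pow_J {N : ℕ} {R : Type*} [CommRing R] [Algebra ℂ R] (I : R →ₗ[ℂ] ℂ)
    (X : Matrix (Fin N) (Fin N) R) (k : ℕ) (i j : Fin N) (r : R) (z : ℤ) :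
    (MD N ^ k) i j (J I (MvPolynomial.C r * dp (trAX X) z))
      = J I (MvPolynomial.C (r * (X ^ k) i j) * dp (trAX X) (z - k)) := by
  induction k generalizing i j r z with
  | zero =>
    simp only [pow_zero, Matrix.one_apply, Nat.cast_zero, sub_zero]
    split_ifs
    · simp
    · ext m; simp [coeff_J]
  | succ k ih =>
    have h : ∀ l, (MD N) l j (J I (MvPolynomial.C r * dp (trAX X) z))
        = J I (MvPolynomial.C (r * X l j) * dp (trAX X) (z - 1)) := by
      intro l
      change MvPolynomial.pderiv (j, l) _ = _
      rw [pderiv_J, MvPolynomial.pderiv_C_mul, pderiv_dp, pderiv_trAX, map_mul]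
      congr 1
      ring
    rw [pow_succ, pow_succ, Matrix.mul_apply, Matrix.mul_apply, LinearMap.sum_apply]
    simp only [Module.End.mul_apply, h, ih]
    rw [← J_sum, ← Finset.sum_mul, ← map_sum]
    congr 3
    · rw [Finset.mul_sum]
      exact Finset.sum_congr rfl fun _ _ => by ring
    · push_cast; ring

lemma MD_trace_J {N : ℕ} {R : Type*} [CommRing R] [Algebra ℂ R] (I : R →ₗ[ℂ] ℂ)
    (X : Matrix (Fin N) (Fin N) R) (k : ℕ) (c : ℂ) (hc : (X ^ k).trace = algebraMap ℂ R c) (z : ℤ) :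
    (MD N ^ k).trace (J I (dp (trAX X) z)) = c • J I (dp (trAX X) (z - k)) := by
  rw [← J_C_algebraMap, ← hc, Matrix.trace, Matrix.trace, LinearMap.sum_apply, map_sum,
    Finset.sum_mul, J_sum]
  refine Finset.sum_congr rfl fun i _ => ?_
  have := MD_pow_J I X k i i 1 z
  rw [map_one, one_mul, one_mul] at this
  exact this

/-! ### The exponential determinant side -/

/-- linear form -/
noncomputable def lf {N : ℕ} (c : Fin N → ℂ) : MvPolynomial (Fin N) ℂ :=
  ∑ i, MvPolynomial.C (c i) * MvPolynomial.X i

lemma pderiv_lf {N : ℕ} (c : Fin N → ℂ) (k : Fin N) :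
    MvPolynomial.pderiv k (lf c) = MvPolynomial.C (c k) := by
  simp only [lf, map_sum, MvPolynomial.pderiv_C_mul, MvPolynomial.pderiv_X, Pi.single_apply,
    mul_ite, mul_one, mul_zero]
  simp

lemma pd_pow_lf {N : ℕ} (c : Fin N → ℂ) (i : Fin N) (k : ℕ) (z : ℤ) :
    (pd i ^ k) (dp (lf c) z) = (c i ^ k) • dp (lf c) (z - k) := by
  induction k generalizing z with
  | zero => simp
  | succ k ih =>
    rw [pow_succ, Module.End.mul_apply, pd_apply, pderiv_dp, pderiv_lf, mul_comm,
      MvPolynomial.C_mul', map_smul, ih, smul_smul, pow_succ, mul_comm (c i)]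
    congr 2
    push_cast; ring

lemma coeff_dp_lf {N : ℕ} (c : Fin N → ℂ) (n : ℕ) (m : Fin N →₀ ℕ) (hm : ∑ i, m i = n) (z : ℤ) :
    (dp (lf c) z).coeff m = if z = n then ∏ i, (c i ^ m i * ((m i).factorial : ℂ)⁻¹) else 0 := by
  induction n generalizing m z with
  | zero =>
    have : m = 0 := by
      ext i
      exact (Finset.sum_eq_zero_iff.1 hm) i (Finset.mem_univ i)
    subst this
    have h0 : MvPolynomial.constantCoeff (lf c) = 0 := by simp [lf]
    rcases lt_trichotomy z 0 with h | h | h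
    · rw [dp_neg _ h, if_neg (by push_cast; omega)]; simp
    · subst h
      simp [dp]
    · obtain ⟨k, rfl⟩ := Int.eq_ofNat_of_zero_le h.le
      rw [dp_nat, if_neg (by push_cast; omega), MvPolynomial.coeff_smul,
        ← MvPolynomial.constantCoeff_eq, map_pow, h0, zero_pow (by omega), smul_zero]
  | succ n ih =>
    have : ∃ i, m i ≠ 0 := by
      by_contra! h
      simp [h] at hm
    obtain ⟨i, hi⟩ := this
    have hm1 : m - Finsupp.single i 1 + Finsupp.single i 1 = m :=
      Finsupp.sub_add_single_one_cancel hi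
    set m' := m - Finsupp.single i 1 with hm'
    have hsum : ∑ j, m' j = n := by
      rw [← hm1] at hm
      simp only [Finsupp.add_apply, Finset.sum_add_distrib] at hm
      have h1 : ∑ j, (Finsupp.single i 1 : Fin N →₀ ℕ) j = 1 := by
        simp [Finsupp.single_apply]
      omega
    have h1 := ih m' hsum (z - 1)
    have h2 := MvPolynomial.coeff_pderiv (i := i) (dp (lf c) z) m'
    rw [pderiv_dp, pderiv_lf, mul_comm, MvPolynomial.coeff_C_mul, h1, hm1] at h2
    have h3 : ((m' i : ℂ) + 1) ≠ 0 := by exact_mod_cast (m' i).succ_ne_zero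
    rw [← mul_left_inj' h3, ← h2]
    have hz : z - 1 = (n : ℤ) ↔ z = ((n + 1 : ℕ) : ℤ) := by push_cast; omega
    simp only [hz]
    split_ifs
    · rw [← Finset.mul_prod_erase Finset.univ _ (Finset.mem_univ i),
        ← Finset.mul_prod_erase Finset.univ (fun j => c j ^ m j * ((m j).factorial : ℂ)⁻¹)
          (Finset.mem_univ i)]
      have he : ∏ x ∈ Finset.univ.erase i, (c x ^ m' x * ((m' x).factorial : ℂ)⁻¹)
          = ∏ x ∈ Finset.univ.erase i, (c x ^ m x * ((m x).factorial : ℂ)⁻¹) := by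
        refine Finset.prod_congr rfl fun x hx => ?_
        have : m x = m' x := by
          rw [← hm1, Finsupp.add_apply, Finsupp.single_eq_of_ne (Finset.ne_of_mem_erase hx), add_zero]
        rw [this]
      rw [he]
      have : m i = m' i + 1 := by
        rw [← hm1, Finsupp.add_apply, Finsupp.single_eq_same]
      rw [this, Nat.factorial_succ]
      have : ((m' i).factorial : ℂ) ≠ 0 := by exact_mod_cast (m' i).factorial_ne_zero
      push_cast
      field_simp
      ring
    · simp

/-- homogeneous parts of the exponential determinant -/
noncomputable def HH {N : ℕ} (b : Fin N → ℂ) (z : ℤ) : MvPolynomial (Fin N) ℂ :=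
  ∑ s : Equiv.Perm (Fin N), ((Equiv.Perm.sign s : ℤ) : ℂ) • dp (lf (fun i => b (s i))) z

lemma HH_psum {N : ℕ} (b : Fin N → ℂ) (z : ℤ) (k : ℕ) :
    (∑ i, pd i ^ k) (HH b z) = (∑ i, b i ^ k) • HH b (z - k) := by
  rw [HH, HH, map_sum, Finset.smul_sum]
  refine Finset.sum_congr rfl fun s _ => ?_
  rw [map_smul, smul_comm, LinearMap.sum_apply]
  congr 1
  simp only [pd_pow_lf]
  rw [← Finset.sum_smul, Equiv.sum_comp s (fun i => b i ^ k)]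

lemma rename_lf {N : ℕ} (c : Fin N → ℂ) (t : Equiv.Perm (Fin N)) :
    MvPolynomial.rename t (lf c) = lf (fun i => c (t⁻¹ i)) := by
  simp only [lf, map_sum, map_mul, MvPolynomial.rename_C, MvPolynomial.rename_X]
  conv_rhs => rw [← Equiv.sum_comp t]
  simp

lemma HH_anti {N : ℕ} (b : Fin N → ℂ) (z : ℤ) : Anti (HH b z) := by
  intro t
  rw [HH, map_sum, Finset.smul_sum, ← Equiv.sum_comp (Equiv.mulRight t)]
  refine Finset.sum_congr rfl fun s _ => ?_
  rw [map_smul, map_dp, rename_lf, smul_smul]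
  simp only [Equiv.coe_mulRight, Equiv.Perm.coe_mul, Function.comp_apply, Equiv.Perm.inv_def, Equiv.apply_symm_apply,
    Equiv.Perm.sign_mul, Units.val_mul, Int.cast_mul]
  rw [mul_comm]

/-- the degree of the Vandermonde -/
def dd (N : ℕ) : ℕ := ∑ i : Fin N, (i : ℕ)

lemma HH_coeff_rho {N : ℕ} (b : Fin N → ℂ) (z : ℤ) :
    (HH b z).coeff (rho N) = if z = dd N then
      (Matrix.vandermonde b).det * ∏ i : Fin N, (((i : ℕ).factorial : ℂ)⁻¹) else 0 := by
  rw [HH, MvPolynomial.coeff_sum]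
  simp only [MvPolynomial.coeff_smul, coeff_dp_lf _ (dd N) (rho N) rfl]
  split_ifs
  · rw [Matrix.det_apply', Finset.sum_mul]
    refine Finset.sum_congr rfl fun s _ => ?_
    simp only [rho_apply, Finset.prod_mul_distrib, Matrix.vandermonde_apply, smul_eq_mul]
    ring
  · simp

lemma rad_coeff_rho {N : ℕ} (f : MvPolynomial (Fin N × Fin N) ℂ) :
    (rad N f).coeff (rho N) = MvPolynomial.eval 0 f := by
  rw [rad_apply, MvPolynomial.coeff_mul, Finset.sum_eq_single (rho N, 0)]
  · rw [vdm_coeff_rho, one_mul, ← MvPolynomial.constantCoeff_eq, ← MvPolynomial.eval_zero]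
    induction f using MvPolynomial.induction_on with
    | C a => simp [res]
    | add p q hp hq => rw [map_add, map_add, map_add, hp, hq]
    | mul_X p a h =>
      rw [map_mul, map_mul, map_mul, h, res]
      simp only [MvPolynomial.aeval_X, MvPolynomial.eval_X]
      split_ifs <;> simp
  · rintro ⟨p, q⟩ hpq hne
    by_contra hc
    have hp : (vdm N).coeff p ≠ 0 := fun e => hc (by rw [e, zero_mul])
    have h1 := vdm_coeff_sum hp
    have h2 : p + q = rho N := Finset.HasAntidiagonal.mem_antidiagonal.1 hpq
    rw [← h2] at h1
    simp only [Finsupp.add_apply, Finset.sum_add_distrib] at h1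
    have h3 : q = 0 := by
      ext i
      exact (Finset.sum_eq_zero_iff.1 (by omega : ∑ i, q i = 0)) i (Finset.mem_univ i)
    subst h3
    rw [add_zero] at h2
    exact hne (by rw [h2])
  · intro h
    exact absurd (Finset.HasAntidiagonal.mem_antidiagonal.2 (by simp)) h

/-- Main algebraic uniqueness statement. -/
lemma main_alg {N : ℕ} (b : Fin N → ℂ) (F : ℤ → MvPolynomial (Fin N × Fin N) ℂ)
    (hinv : ∀ z, Inv (F z)) (hneg : ∀ z < 0, F z = 0)
    (h0 : ∀ z, MvPolynomial.eval 0 (F z) = if z = 0 then 1 else 0)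
    (hanti : ∀ z, Anti (rad N (F z)))
    (hD : ∀ (z : ℤ) (k : ℕ), (MD N ^ k).trace (F z) = (∑ i, b i ^ k) • F (z - k)) (z : ℤ) :
    HH b z = ((Matrix.vandermonde b).det * ∏ i : Fin N, (((i : ℕ).factorial : ℂ)⁻¹)) •
      rad N (F (z - dd N)) := by
  set c := ((Matrix.vandermonde b).det * ∏ i : Fin N, (((i : ℕ).factorial : ℂ)⁻¹)) with hc
  have key : ∀ n : ℕ, ∀ z : ℤ, z < n → HH b z - c • rad N (F (z - dd N)) = 0 := by
    intro n
    induction n with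
    | zero =>
      intro z hz
      have hz : z < 0 := by simpa using hz
      rw [hneg _ (by omega), HH]
      simp [dp_neg _ hz]
    | succ n ih =>
      intro z hz
      apply anti_eq_zero
      · intro s
        rw [map_sub, map_smul, HH_anti b z s, hanti _ s, smul_sub, smul_comm c]
      · intro m hm i
        by_contra! hle
        apply hm
        apply coeff_of_pow_pd i N _ _ m hle
        apply pow_pd_eq_zero
        intro k
        rw [map_sub, map_smul, HH_psum, ← rad_psum _ (hinv _), hD, map_smul, smul_comm c, ← smul_sub]
        have := ih (z - ((k + 1 : ℕ) : ℤ)) (by push_cast at *; omega)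
        rw [sub_right_comm, this, smul_zero]
      · rw [MvPolynomial.coeff_sub, MvPolynomial.coeff_smul, HH_coeff_rho, rad_coeff_rho, h0]
        by_cases h : z = dd N
        · simp [h, hc]
        · rw [if_neg h, if_neg (by omega)]; simp
  exact sub_eq_zero.1 (key (z.toNat + 1) z (by push_cast; omega))

/-! ### Infinitesimal invariance -/

lemma eval_chain {σ : Type*} [Fintype σ] (c : ℝ → σ → ℂ) (c' : σ → ℂ) (t : ℝ)
    (hc : ∀ s, HasDerivAt (fun t => c t s) (c' s) t) (p : MvPolynomial σ ℂ) :
    HasDerivAt (fun t => MvPolynomial.eval (c t) p)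
      (∑ s, MvPolynomial.eval (c t) (MvPolynomial.pderiv s p) * c' s) t := by
  induction p using MvPolynomial.induction_on with
  | C a =>
    simp only [MvPolynomial.eval_C, MvPolynomial.pderiv_C, map_zero, zero_mul,
      Finset.sum_const_zero]
    exact hasDerivAt_const t a
  | add p q hp hq =>
    simp only [map_add, add_mul, Finset.sum_add_distrib]
    exact hp.add hq
  | mul_X p i hp =>
    classical
    simp only [map_mul, MvPolynomial.eval_X]
    refine (hp.mul (hc i)).congr_deriv ?_
    have : ∀ s, MvPolynomial.eval (c t) (MvPolynomial.pderiv s (p * MvPolynomial.X i)) * c' s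
        = MvPolynomial.eval (c t) (MvPolynomial.pderiv s p) * c' s * c t i
          + if s = i then MvPolynomial.eval (c t) p * c' i else 0 := by
      intro s
      rw [MvPolynomial.pderiv_mul, MvPolynomial.pderiv_X]
      by_cases h : s = i
      · subst h
        simp
        ring
      · rw [Pi.single_eq_of_ne (Ne.symm h), if_neg h]
        simp
        ring
    rw [Finset.sum_congr rfl fun s _ => this s, Finset.sum_add_distrib, ← Finset.sum_mul]
    simp

/-- evaluation at a matrix -/
noncomputable def evM {N : ℕ} (A : Matrix (Fin N) (Fin N) ℂ)
    (f : MvPolynomial (Fin N × Fin N) ℂ) : ℂ := MvPolynomial.eval (fun p => A p.1 p.2) f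

section
attribute [local instance] Matrix.linftyOpNormedRing Matrix.linftyOpNormedAlgebra

lemma conj_deriv {N : ℕ} (A h : Matrix (Fin N) (Fin N) ℂ) (k l : Fin N) :
    HasDerivAt (fun t : ℝ => (NormedSpace.exp (t • h) * A * NormedSpace.exp (t • (-h))) k l)
      ((h * A - A * h) k l) 0 := by
  have h1 := ((hasDerivAt_exp_smul_const (𝕂 := ℝ) h (0 : ℝ)).mul_const A).mul
    (hasDerivAt_exp_smul_const (𝕂 := ℝ) (-h) (0 : ℝ))
  have h2 := (LinearMap.toContinuousLinearMap
    (Matrix.entryLinearMap ℝ ℂ k l : Matrix (Fin N) (Fin N) ℂ →ₗ[ℝ] ℂ)).hasFDerivAt.comp_hasDerivAt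
      (0 : ℝ) h1
  have h3 : NormedSpace.exp ((0 : ℝ) • h) * h * A * NormedSpace.exp ((0 : ℝ) • (-h)) +
      NormedSpace.exp ((0 : ℝ) • h) * A * (NormedSpace.exp ((0 : ℝ) • (-h)) * (-h))
      = h * A - A * h := by
    simp only [zero_smul, NormedSpace.exp_zero, one_mul, mul_one, mul_neg, sub_eq_add_neg]
  exact h2.congr_deriv (congrFun (congrFun h3 k) l)

end

lemma exp_unitary {N : ℕ} (h : Matrix (Fin N) (Fin N) ℂ) (hh : star h = -h) (t : ℝ) :
    ∃ V ∈ Matrix.unitaryGroup (Fin N) ℂ, V = NormedSpace.exp (t • h)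
      ∧ star V = NormedSpace.exp (t • (-h)) := by
  have e : star (t • h) = t • (-h) := by rw [star_smul, hh]; simp
  have hs : star (NormedSpace.exp (t • h)) = NormedSpace.exp (t • (-h)) := by
    rw [← e, Matrix.star_eq_conjTranspose, Matrix.star_eq_conjTranspose, Matrix.exp_conjTranspose]
  refine ⟨_, ?_, rfl, hs⟩
  rw [Matrix.mem_unitaryGroup_iff, hs, ← Matrix.exp_add_of_commute, smul_neg, add_neg_cancel,
    NormedSpace.exp_zero]
  rw [smul_neg]
  exact (Commute.refl _).neg_right

lemma skew_inv {N : ℕ} (f : MvPolynomial (Fin N × Fin N) ℂ)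
    (hf : ∀ V ∈ Matrix.unitaryGroup (Fin N) ℂ, ∀ A, evM (V * A * star V) f = evM A f)
    (A h : Matrix (Fin N) (Fin N) ℂ) (hh : star h = -h) :
    ∑ s : Fin N × Fin N, evM A (MvPolynomial.pderiv s f) * (h * A - A * h) s.1 s.2 = 0 := by
  have h1 := eval_chain (fun (t : ℝ) (s : Fin N × Fin N) =>
    (NormedSpace.exp (t • h) * A * NormedSpace.exp (t • (-h))) s.1 s.2)
    (fun s => (h * A - A * h) s.1 s.2) 0 (fun s => conj_deriv A h s.1 s.2) f
  have h2 : (fun t : ℝ => MvPolynomial.eval (fun (s : Fin N × Fin N) =>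
    (NormedSpace.exp (t • h) * A * NormedSpace.exp (t • (-h))) s.1 s.2) f)
      = fun t : ℝ => evM A f := by
    funext t
    obtain ⟨V, hV, h3, h4⟩ := exp_unitary h hh t
    rw [← h3, ← h4]
    exact hf V hV A
  rw [h2] at h1
  have h3 := h1.unique (hasDerivAt_const (0 : ℝ) (evM A f))
  simp only [zero_smul, NormedSpace.exp_zero, one_mul, mul_one] at h3
  exact h3

lemma evM_xi {N : ℕ} (f : MvPolynomial (Fin N × Fin N) ℂ) (A : Matrix (Fin N) (Fin N) ℂ)
    (i j : Fin N) : evM A (xi i j f) = ∑ s : Fin N × Fin N, evM A (MvPolynomial.pderiv s f) *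
      (Matrix.single i j (1 : ℂ) * A - A * Matrix.single i j (1 : ℂ)) s.1 s.2 := by
  rw [xi_apply, Fintype.sum_prod_type]
  simp only [evM, map_sum, map_sub, map_mul, MvPolynomial.eval_X, Matrix.sub_apply, mul_sub,
    Finset.sum_sub_distrib]
  simp only [Matrix.mul_apply, Matrix.single_apply, ite_and, ite_mul, mul_ite, zero_mul, mul_zero,
    one_mul, mul_one, Finset.sum_ite_irrel, Finset.sum_ite_eq, Finset.sum_ite_eq',
    Finset.sum_const_zero, Finset.mem_univ, if_true]
  simp only [mul_comm]

lemma inv_of_unitary {N : ℕ} (f : MvPolynomial (Fin N × Fin N) ℂ)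
    (hf : ∀ V ∈ Matrix.unitaryGroup (Fin N) ℂ, ∀ A, evM (V * A * star V) f = evM A f) :
    Inv f := by
  intro i j _
  apply MvPolynomial.funext
  intro x
  rw [map_zero]
  set A : Matrix (Fin N) (Fin N) ℂ := fun k l => x (k, l) with hA
  change evM A (xi i j f) = 0
  rw [evM_xi]
  have h1 := skew_inv f hf A (Matrix.single i j (1 : ℂ) - Matrix.single j i (1 : ℂ)) (by
    simp [Matrix.star_eq_conjTranspose, Matrix.conjTranspose_sub])
  have h2 := skew_inv f hf A (Complex.I • (Matrix.single i j (1 : ℂ) + Matrix.single j i (1 : ℂ))) (by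
    rw [star_smul, star_add, Matrix.star_eq_conjTranspose, Matrix.star_eq_conjTranspose,
      Matrix.conjTranspose_single, Matrix.conjTranspose_single, add_comm]
    simp [add_comm])
  have h3 : ∑ s : Fin N × Fin N, evM A (MvPolynomial.pderiv s f) *
      (Matrix.single i j (1 : ℂ) * A - A * Matrix.single i j (1 : ℂ)) s.1 s.2
      = (1 / 2 : ℂ) * (0 + (- Complex.I) * 0) := by
    conv_rhs => enter [2]; arg 1; rw [← h1]
    conv_rhs => enter [2]; arg 2; arg 2; rw [← h2]
    rw [Finset.mul_sum, ← Finset.sum_add_distrib, Finset.mul_sum]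
    refine Finset.sum_congr rfl fun s _ => ?_
    simp only [Matrix.sub_mul, Matrix.mul_sub, Matrix.smul_mul, Matrix.mul_smul, Matrix.add_mul,
      Matrix.mul_add, Matrix.sub_apply, Matrix.add_apply, Matrix.smul_apply, smul_eq_mul]
    linear_combination (1 / 2 * evM A (MvPolynomial.pderiv s f) * ((Matrix.single i j (1 : ℂ) * A) s.1 s.2 + (Matrix.single j i (1 : ℂ) * A) s.1 s.2 - ((A * Matrix.single i j (1 : ℂ)) s.1 s.2 + (A * Matrix.single j i (1 : ℂ)) s.1 s.2))) * Complex.I_sq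
  rw [h3]; simp

lemma eval_res {N : ℕ} (a : Fin N → ℂ) (f : MvPolynomial (Fin N × Fin N) ℂ) :
    MvPolynomial.eval a (res N f) = evM (Matrix.diagonal a) f := by
  rw [evM]
  induction f using MvPolynomial.induction_on with
  | C a => simp [res]
  | add p q hp hq => rw [map_add, map_add, map_add, hp, hq]
  | mul_X p s h =>
    rw [map_mul, map_mul, map_mul, h, MvPolynomial.eval_X, Matrix.diagonal_apply, res,
      MvPolynomial.aeval_X]
    split_ifs <;> simp

lemma eval_rad {N : ℕ} (a : Fin N → ℂ) (f : MvPolynomial (Fin N × Fin N) ℂ) :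
    MvPolynomial.eval a (rad N f) = (Matrix.vandermonde a).det * evM (Matrix.diagonal a) f := by
  rw [rad_apply, map_mul, eval_res, vdm, RingHom.map_det]
  congr 2
  ext i j
  simp [Matrix.vandermonde_apply]

lemma perm_unitary {N : ℕ} (s : Equiv.Perm (Fin N)) (a : Fin N → ℂ) :
    ∃ V ∈ Matrix.unitaryGroup (Fin N) ℂ, V * Matrix.diagonal a * star V
      = Matrix.diagonal (fun i => a (s i)) := by
  refine ⟨(1 : Matrix (Fin N) (Fin N) ℂ).submatrix s id, ?_, ?_⟩
  · rw [Matrix.mem_unitaryGroup_iff]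
    ext i j
    simp [Matrix.mul_apply, Matrix.one_apply, Matrix.star_apply]
  · ext i j
    simp [Matrix.mul_apply, Matrix.one_apply, Matrix.star_apply, Matrix.diagonal_apply]
    split_ifs with h
    · rw [h]
    · rfl

lemma rad_anti {N : ℕ} (f : MvPolynomial (Fin N × Fin N) ℂ)
    (hf : ∀ V ∈ Matrix.unitaryGroup (Fin N) ℂ, ∀ A, evM (V * A * star V) f = evM A f) :
    Anti (rad N f) := by
  intro s
  rw [rad_apply, map_mul, vdm_anti N s, smul_mul_assoc]
  congr 2
  apply MvPolynomial.funext
  intro a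
  rw [MvPolynomial.eval_rename, eval_res, eval_res]
  obtain ⟨V, hV, h⟩ := perm_unitary s a
  rw [← hf V hV (Matrix.diagonal a), h]
  rfl
/-! ### The unitary integral -/

lemma compact_unitary (N : ℕ) : CompactSpace (Matrix.unitaryGroup (Fin N) ℂ) := by
  refine (isCompact_iff_compactSpace
    (s := (Matrix.unitaryGroup (Fin N) ℂ : Set (Matrix (Fin N) (Fin N) ℂ)))).1 ?_
  have h1 : IsCompact (Set.pi Set.univ (fun _ : Fin N => Set.pi Set.univ
      (fun _ : Fin N => Metric.closedBall (0 : ℂ) 1))) :=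
    isCompact_univ_pi fun _ => isCompact_univ_pi fun _ => isCompact_closedBall 0 1
  refine IsCompact.of_isClosed_subset (X := Matrix (Fin N) (Fin N) ℂ) h1 ?_ ?_
  · have : (Matrix.unitaryGroup (Fin N) ℂ : Set (Matrix (Fin N) (Fin N) ℂ))
        = {U | U * star U = 1} := by
      ext U
      exact Matrix.mem_unitaryGroup_iff
    rw [this]
    exact isClosed_eq (by fun_prop) continuous_const
  · intro U hU i _ j _
    rw [mem_closedBall_zero_iff]
    exact entry_norm_bound_of_unitary hU i j

section
variable {N : ℕ} [MeasurableSpace (Matrix.unitaryGroup (Fin N) ℂ)]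
    [BorelSpace (Matrix.unitaryGroup (Fin N) ℂ)]
    (μ : Measure (Matrix.unitaryGroup (Fin N) ℂ))
    [μ.IsHaarMeasure]

lemma integrable_cont (f : C(Matrix.unitaryGroup (Fin N) ℂ, ℂ)) : Integrable f μ := by
  haveI := compact_unitary N
  exact f.continuous.integrable_of_hasCompactSupport (HasCompactSupport.of_compactSpace _)

lemma integrable_contR (f : C(Matrix.unitaryGroup (Fin N) ℂ, ℝ)) : Integrable f μ := by
  haveI := compact_unitary N
  exact f.continuous.integrable_of_hasCompactSupport (HasCompactSupport.of_compactSpace _)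

/-- integration as a linear functional -/
noncomputable def II : C(Matrix.unitaryGroup (Fin N) ℂ, ℂ) →ₗ[ℂ] ℂ where
  toFun f := ∫ U, f U ∂μ
  map_add' f g := integral_add (integrable_cont μ f) (integrable_cont μ g)
  map_smul' c f := integral_const_mul c f

lemma II_apply (f : C(Matrix.unitaryGroup (Fin N) ℂ, ℂ)) : II μ f = ∫ U, f U ∂μ := rfl

end

/-- The conjugated matrix as a matrix of continuous functions. -/
noncomputable def XX {N : ℕ} (b : Fin N → ℂ) :
    Matrix (Fin N) (Fin N) C(Matrix.unitaryGroup (Fin N) ℂ, ℂ) := fun i j =>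
  ⟨fun U => (U.1 * Matrix.diagonal b * star U.1) i j, by
    apply Continuous.matrix_elem
    fun_prop⟩

/-- evaluation at a unitary matrix -/
noncomputable def evU {N : ℕ} (U : Matrix.unitaryGroup (Fin N) ℂ) :
    C(Matrix.unitaryGroup (Fin N) ℂ, ℂ) →ₐ[ℂ] ℂ := ContinuousMap.evalAlgHom ℂ ℂ U

lemma evU_apply {N : ℕ} (U : Matrix.unitaryGroup (Fin N) ℂ)
    (f : C(Matrix.unitaryGroup (Fin N) ℂ, ℂ)) : evU U f = f U := rfl

lemma XX_map {N : ℕ} (b : Fin N → ℂ) (U : Matrix.unitaryGroup (Fin N) ℂ) :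
    (evU U).mapMatrix (XX b) = U.1 * Matrix.diagonal b * star U.1 := by
  ext i j
  rfl

lemma conj_pow {N : ℕ} (B : Matrix (Fin N) (Fin N) ℂ) (U : Matrix.unitaryGroup (Fin N) ℂ) (k : ℕ) :
    (U.1 * B * star U.1) ^ k = U.1 * B ^ k * star U.1 := by
  have h1 : U.1 * star U.1 = 1 := Matrix.mem_unitaryGroup_iff.1 U.2
  have h2 : star U.1 * U.1 = 1 := Matrix.mem_unitaryGroup_iff'.1 U.2
  induction k with
  | zero => simp [h1]
  | succ k ih =>
    rw [pow_succ, ih, pow_succ]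
    calc U.1 * B ^ k * star U.1 * (U.1 * B * star U.1)
        = U.1 * B ^ k * (star U.1 * U.1) * B * star U.1 := by simp only [mul_assoc]
      _ = _ := by rw [h2, mul_one]; simp only [mul_assoc]

lemma XX_trace {N : ℕ} (b : Fin N → ℂ) (k : ℕ) :
    (XX b ^ k).trace = algebraMap ℂ _ (∑ i, b i ^ k) := by
  ext U
  have h2 : star U.1 * U.1 = 1 := Matrix.mem_unitaryGroup_iff'.1 U.2
  have h : evU U (XX b ^ k).trace = ((evU U).mapMatrix (XX b ^ k)).trace := by
    simp [Matrix.trace]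
  rw [← evU_apply, ← evU_apply, h, map_pow, XX_map, conj_pow, Matrix.trace_mul_comm, ← mul_assoc,
    h2, one_mul, Matrix.diagonal_pow, Matrix.trace_diagonal]
  simp

lemma eval_dp {σ R : Type*} [CommRing R] [Algebra ℂ R] (x : σ → R) (p : MvPolynomial σ R) (z : ℤ) :
    MvPolynomial.eval x (dp p z) = dp (MvPolynomial.eval x p) z := by
  unfold dp
  split_ifs
  · exact map_zero _
  · rw [← map_pow, Algebra.smul_def, map_mul, Algebra.smul_def, MvPolynomial.algebraMap_apply,
      MvPolynomial.eval_C]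

/-- The homogeneous pieces of the integral. -/
noncomputable def FF {N : ℕ} [MeasurableSpace (Matrix.unitaryGroup (Fin N) ℂ)]
    [BorelSpace (Matrix.unitaryGroup (Fin N) ℂ)]
    (μ : Measure (Matrix.unitaryGroup (Fin N) ℂ)) [μ.IsHaarMeasure]
    (b : Fin N → ℂ) (z : ℤ) : MvPolynomial (Fin N × Fin N) ℂ :=
  J (II μ) (dp (trAX (XX b)) z)

section
variable {N : ℕ} [MeasurableSpace (Matrix.unitaryGroup (Fin N) ℂ)]
    [BorelSpace (Matrix.unitaryGroup (Fin N) ℂ)]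
    (μ : Measure (Matrix.unitaryGroup (Fin N) ℂ))
    [μ.IsHaarMeasure]

lemma evM_FF (b : Fin N → ℂ) (z : ℤ) (A : Matrix (Fin N) (Fin N) ℂ) :
    evM A (FF μ b z) = ∫ U : Matrix.unitaryGroup (Fin N) ℂ,
      dp ((A * (U.1 * Matrix.diagonal b * star U.1)).trace) z ∂μ := by
  rw [evM, FF, eval_J, II_apply]
  refine integral_congr_ae (Filter.Eventually.of_forall fun U => ?_)
  simp only
  rw [← evU_apply, eval_dp, map_dp]
  congr 1
  rw [Matrix.trace]
  simp only [trAX, map_sum, map_mul, MvPolynomial.eval_C, MvPolynomial.eval_X, Matrix.diag,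
    AlgHom.commutes]
  refine Finset.sum_congr rfl fun i _ => ?_
  rw [Matrix.mul_apply]
  refine Finset.sum_congr rfl fun j _ => ?_
  rw [mul_comm]
  rfl

lemma FF_inv (b : Fin N → ℂ) (z : ℤ) : ∀ V ∈ Matrix.unitaryGroup (Fin N) ℂ, ∀ A,
    evM (V * A * star V) (FF μ b z) = evM A (FF μ b z) := by
  intro V hV A
  rw [evM_FF, evM_FF, ← integral_mul_left_eq_self (μ := μ) _ (⟨V, hV⟩ : Matrix.unitaryGroup (Fin N) ℂ)]
  refine integral_congr_ae (Filter.Eventually.of_forall fun U => ?_)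
  have h2 : star V * V = 1 := Matrix.mem_unitaryGroup_iff'.1 hV
  simp only [Submonoid.coe_mul, star_mul]
  congr 1
  calc (V * A * star V * (V * U.1 * Matrix.diagonal b * (star U.1 * star V))).trace
      = (V * (A * (star V * V) * (U.1 * Matrix.diagonal b * star U.1) * star V)).trace := by
        simp only [mul_assoc]
    _ = (A * (star V * V) * (U.1 * Matrix.diagonal b * star U.1) * (star V * V)).trace := by
        rw [Matrix.trace_mul_comm]; simp only [mul_assoc]
    _ = _ := by rw [h2, mul_one, mul_one]

lemma FF_main [IsProbabilityMeasure μ] (b : Fin N → ℂ) (z : ℤ) :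
    HH b z = ((Matrix.vandermonde b).det * ∏ i : Fin N, (((i : ℕ).factorial : ℂ)⁻¹)) •
      rad N (FF μ b (z - dd N)) := by
  apply main_alg b (FF μ b)
  · exact fun z => inv_of_unitary _ (FF_inv μ b z)
  · intro z hz
    rw [FF, dp_neg _ hz]
    ext m
    simp [coeff_J]
  · intro z
    have h := evM_FF μ b z 0
    rw [evM] at h
    have e : (fun p : Fin N × Fin N => (0 : Matrix (Fin N) (Fin N) ℂ) p.1 p.2) = 0 := rfl
    rw [e] at h
    rw [h]
    simp only [zero_mul, Matrix.trace_zero, integral_const, probReal_univ, one_smul]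
    rcases lt_trichotomy z 0 with h | h | h
    · rw [dp_neg _ h, if_neg h.ne]
    · subst h; simp [dp]
    · rw [if_neg h.ne', dp, if_neg h.le.not_gt, zero_pow (by omega), smul_zero]
  · exact fun z => rad_anti _ (FF_inv μ b z)
  · exact fun z k => MD_trace_J (II μ) (XX b) k _ (XX_trace b k) z

lemma hasSum_dp (x : ℂ) : HasSum (fun n : ℕ => dp x (n : ℤ)) (Complex.exp x) := by
  have := NormedSpace.expSeries_hasSum_exp_of_mem_ball' (𝕂 := ℂ) x (by
    rw [NormedSpace.expSeries_radius_eq_top]; exact edist_lt_top _ _)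
  rw [← Complex.exp_eq_exp_ℂ] at this
  simpa only [dp_nat] using this

lemma hasSum_FF (a b : Fin N → ℂ) :
    HasSum (fun n : ℕ => evM (Matrix.diagonal a) (FF μ b n))
      (∫ U : Matrix.unitaryGroup (Fin N) ℂ,
        Complex.exp ((Matrix.diagonal a * U.1 * Matrix.diagonal b * star U.1).trace) ∂μ) := by
  simp only [evM_FF]
  have hc : Continuous fun U : Matrix.unitaryGroup (Fin N) ℂ =>
      (Matrix.diagonal a * (U.1 * Matrix.diagonal b * star U.1)).trace := by
    apply Continuous.matrix_trace
    fun_prop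
  have hn : ∀ x : ℂ, HasSum (fun n : ℕ => ‖x‖ ^ n / n.factorial) (Real.exp ‖x‖) := by
    intro x
    rw [Real.exp_eq_exp_ℝ]
    exact NormedSpace.expSeries_div_hasSum_exp _
  refine hasSum_integral_of_dominated_convergence
    (fun n U => ‖(Matrix.diagonal a * (U.1 * Matrix.diagonal b * star U.1)).trace‖ ^ n / n.factorial)
    ?_ ?_ ?_ ?_ ?_
  · intro n
    apply Continuous.aestronglyMeasurable
    simp only [dp_nat]
    fun_prop
  · intro n
    refine Filter.Eventually.of_forall fun U => ?_
    rw [dp_nat, norm_smul, norm_pow, norm_inv, Complex.norm_natCast, div_eq_inv_mul]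
  · exact Filter.Eventually.of_forall fun U => (hn _).summable
  · simp only [fun x => (hn x).tsum_eq]
    exact integrable_contR μ ⟨_, Real.continuous_exp.comp hc.norm⟩
  · refine Filter.Eventually.of_forall fun U => ?_
    have := hasSum_dp ((Matrix.diagonal a * (U.1 * Matrix.diagonal b * star U.1)).trace)
    simpa only [mul_assoc] using this

end

lemma eval_HH {N : ℕ} (a b : Fin N → ℂ) (z : ℤ) : MvPolynomial.eval a (HH b z)
    = ∑ s : Equiv.Perm (Fin N), ((Equiv.Perm.sign s : ℤ) : ℂ) * dp (∑ i, a i * b (s i)) z := by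
  rw [HH, map_sum]
  refine Finset.sum_congr rfl fun s _ => ?_
  rw [MvPolynomial.smul_eval]
  congr 1
  rw [← MvPolynomial.coe_aeval_eq_eval]
  change MvPolynomial.aeval a (dp _ z) = _
  rw [map_dp]
  congr 1
  simp [lf, mul_comm]

lemma hasSum_HH {N : ℕ} (a b : Fin N → ℂ) :
    HasSum (fun n : ℕ => MvPolynomial.eval a (HH b n))
      (Matrix.of fun i j => Complex.exp (a i * b j)).det := by
  simp only [eval_HH]
  rw [← Matrix.det_transpose, Matrix.det_apply']
  refine hasSum_sum fun s _ => ?_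
  have := (hasSum_dp (∑ i, a i * b (s i))).mul_left ((Equiv.Perm.sign s : ℤ) : ℂ)
  rw [Complex.exp_sum] at this
  exact this

lemma prod_fact {N : ℕ} (hN : 1 ≤ N) :
    ∏ i : Fin N, ((i : ℕ).factorial : ℂ) = ∏ k ∈ Finset.Icc 1 (N - 1), (k.factorial : ℂ) := by
  rw [Fin.prod_univ_eq_prod_range (fun i => (i.factorial : ℂ)) N]
  obtain ⟨M, rfl⟩ := Nat.exists_eq_add_of_le' hN
  rw [Finset.prod_range_succ', Nat.add_sub_cancel, Finset.range_eq_Ico,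
    Finset.prod_Ico_add' (fun k => (k.factorial : ℂ)) 0 M 1]
  simp
  rfl

end HCIZ

theorem itzykson_zuber_harish_chandra
    (N : ℕ) (hN : 1 ≤ N)
    [MeasurableSpace (Matrix.unitaryGroup (Fin N) ℂ)]
    [BorelSpace (Matrix.unitaryGroup (Fin N) ℂ)]
    (μ : Measure (Matrix.unitaryGroup (Fin N) ℂ))
    [μ.IsHaarMeasure] [IsProbabilityMeasure μ]
    (a b : Fin N → ℂ) (ha : Function.Injective a) (hb : Function.Injective b) :
    (∫ U : Matrix.unitaryGroup (Fin N) ℂ,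
        Complex.exp ((Matrix.diagonal a * U.1 * Matrix.diagonal b * star U.1).trace) ∂μ)
      = (∏ k ∈ Finset.Icc 1 (N - 1), (Nat.factorial k : ℂ)) *
          (Matrix.of fun i j => Complex.exp (a i * b j)).det /
        ((∏ i : Fin N, ∏ j ∈ Finset.Ioi i, (a j - a i)) *
          (∏ i : Fin N, ∏ j ∈ Finset.Ioi i, (b j - b i))) := by
  rw [← Matrix.det_vandermonde, ← Matrix.det_vandermonde, ← HCIZ.prod_fact hN]
  have hva : (Matrix.vandermonde a).det ≠ 0 := Matrix.det_vandermonde_ne_zero_iff.2 ha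
  have hvb : (Matrix.vandermonde b).det ≠ 0 := Matrix.det_vandermonde_ne_zero_iff.2 hb
  have hf : ∏ i : Fin N, ((i : ℕ).factorial : ℂ) ≠ 0 :=
    Finset.prod_ne_zero_iff.2 fun i _ => by exact_mod_cast (i : ℕ).factorial_ne_zero
  have h1 := HCIZ.hasSum_HH a b
  rw [← hasSum_nat_add_iff' (HCIZ.dd N)] at h1
  have hz : ∑ i ∈ Finset.range (HCIZ.dd N), MvPolynomial.eval a (HCIZ.HH b (i : ℤ)) = 0 := by
    refine Finset.sum_eq_zero fun i hi => ?_
    have hi := Finset.mem_range.1 hi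
    rw [HCIZ.FF_main μ, MvPolynomial.smul_eval, HCIZ.eval_rad, HCIZ.evM_FF]
    have : (i : ℤ) - HCIZ.dd N < 0 := by omega
    simp [HCIZ.dp_neg _ this]
  rw [hz, sub_zero] at h1
  have h2 := (HCIZ.hasSum_FF μ a b).mul_left (((Matrix.vandermonde b).det *
    ∏ i : Fin N, (((i : ℕ).factorial : ℂ)⁻¹)) * (Matrix.vandermonde a).det)
  have h3 : (fun n : ℕ => MvPolynomial.eval a (HCIZ.HH b ((n + HCIZ.dd N : ℕ) : ℤ)))
      = fun n : ℕ => (((Matrix.vandermonde b).det *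
    ∏ i : Fin N, (((i : ℕ).factorial : ℂ)⁻¹)) * (Matrix.vandermonde a).det) *
      HCIZ.evM (Matrix.diagonal a) (HCIZ.FF μ b n) := by
    funext n
    rw [HCIZ.FF_main μ, MvPolynomial.smul_eval, HCIZ.eval_rad]
    have e : ((n + HCIZ.dd N : ℕ) : ℤ) - HCIZ.dd N = n := by push_cast; ring
    rw [e]
    ring
  rw [h3] at h1
  rw [h1.unique h2, Finset.prod_inv_distrib]
  field_simp
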